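/- Let k be an algebraically closed field of characteristic p > 2. The Betti numbers of the R-modules A and B satisfy: β_0(A) = 3 and β_i(A) = 8·3^(i−1) for all i ≥ 1; and β_i(B) = 8·3^i for all i ≥ 0. -/

import Mathlib

open MvPolynomial CategoryTheory Filter

set_option synthInstance.maxHeartbeats 1000000
set_option maxHeartbeats 2000000

noncomputable section

variable (k : Type) [Field k]

/-- `R = k[x², y², z², xy, xz, yz]`, the second Veronese subalgebra of `S = k[x,y,z]`. -/
def Rv2 : Subalgebra k (MvPolynomial (Fin 3) k) :=
  Algebra.adjoin k
    {X 0 ^ 2, X 1 ^ 2, X 2 ^ 2, X 0 * X 1, X 0 * X 2, X 1 * X 2}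

/-- The graded maximal ideal `𝔪 = ⊕_{n≥1} S_{2n}` of `R`: the elements of `R` with zero
constant term. -/
def mV2 : Ideal ↥(Rv2 k) :=
  RingHom.ker ((constantCoeff : MvPolynomial (Fin 3) k →+* k).comp (Rv2 k).val.toRingHom)

/-- The `i`-th Betti number `β_i(M) = dim_k Tor_i^R(M, R/𝔪)` of an `R`-module `M`. -/
def bettiV2 (i : ℕ) (M : Type) [AddCommGroup M] [Module ↥(Rv2 k) M] : ℕ :=
  Module.finrank k (RestrictScalars k ↥(Rv2 k)
    ((((Tor (ModuleCat ↥(Rv2 k)) i).obj (ModuleCat.of ↥(Rv2 k) M)).obj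
      (ModuleCat.of ↥(Rv2 k) (↥(Rv2 k) ⧸ mV2 k)))))

/-- `A = ⊕_{n≥0} S_{2n+1}`, the `R`-submodule of `S` generated by `x, y, z`
(the canonical module of `R` up to a shift). -/
def Av2 : Submodule ↥(Rv2 k) (MvPolynomial (Fin 3) k) :=
  Submodule.span ↥(Rv2 k) {X 0, X 1, X 2}

/-- The map `R³ → A ⊆ S` sending the standard basis elements to `x, y, z`. -/
def pV2 : (Fin 3 → ↥(Rv2 k)) →ₗ[↥(Rv2 k)] MvPolynomial (Fin 3) k :=
  ∑ m : Fin 3,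
    (LinearMap.toSpanSingleton ↥(Rv2 k) (MvPolynomial (Fin 3) k) (X m)).comp
      (LinearMap.proj m)

/-- `B`: the kernel of the map `R³ → A`, i.e. the first syzygy of `A`. -/
def Bv2 : Submodule ↥(Rv2 k) (Fin 3 → ↥(Rv2 k)) := LinearMap.ker (pV2 k)

section Tor

open MonoidalCategory

universe u
variable {R : Type u} [CommRing R]

/-- The functor `M ↦ M ⊗ P` to chain complexes, for a chain complex `P`. -/
def tensorComplexFunctor (P : ChainComplex (ModuleCat.{u} R) ℕ) :
    ModuleCat.{u} R ⥤ ChainComplex (ModuleCat.{u} R) ℕ where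
  obj M := (((tensoringLeft (ModuleCat.{u} R)).obj M).mapHomologicalComplex _).obj P
  map f := (NatTrans.mapHomologicalComplex ((tensoringLeft (ModuleCat.{u} R)).map f) _).app P
  map_id M := by ext; simp
  map_comp f g := by ext; simp

instance (P : ChainComplex (ModuleCat.{u} R) ℕ) : (tensorComplexFunctor P).Additive where
  map_add {M N f g} := by
    ext i : 1
    exact MonoidalPreadditive.add_whiskerRight f g

/-- `Tor` computed from the complexes `M ⊗ P`, for a projective resolution `P`. -/
def torIsoHomology {N : ModuleCat.{u} R} (P : ProjectiveResolution N) (M : ModuleCat.{u} R)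
    (n : ℕ) : ((Tor (ModuleCat.{u} R) n).obj M).obj N ≅
      ((tensorComplexFunctor P.complex).obj M).homology n :=
  P.isoLeftDerivedObj _ n

lemma projectiveResolution_flat {N : ModuleCat.{u} R} (P : ProjectiveResolution N) (n : ℕ) :
    Module.Flat R (P.complex.X n) :=
  have := (IsProjective.iff_projective (P.complex.X n)).mpr (P.projective n)
  inferInstance

lemma tensorComplexFunctor_shortExact {N : ModuleCat.{u} R} (P : ProjectiveResolution N)
    {S : ShortComplex (ModuleCat.{u} R)} (hS : S.ShortExact) :
    (S.map (tensorComplexFunctor P.complex)).ShortExact := by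
  apply HomologicalComplex.shortExact_of_degreewise_shortExact
  intro i
  have := projectiveResolution_flat P i
  exact hS.map_of_exact (tensorRight (P.complex.X i))

/-- `Tor` in degree `n` against `N`, as a functor of the first variable. -/
def torFlip (N : ModuleCat.{u} R) (n : ℕ) : ModuleCat.{u} R ⥤ ModuleCat.{u} R :=
  tensorComplexFunctor (projectiveResolution N).complex ⋙ HomologicalComplex.homologyFunctor _ _ n

instance (N : ModuleCat.{u} R) (n : ℕ) : (torFlip N n).Additive :=
  inferInstanceAs (_ ⋙ _).Additive

/-- The values of `torFlip` are those of `Tor`. -/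
def torEquivTorFlip (M N : ModuleCat.{u} R) (n : ℕ) :
    ((Tor (ModuleCat.{u} R) n).obj M).obj N ≃ₗ[R] (torFlip N n).obj M :=
  (torIsoHomology (projectiveResolution N) M n).toLinearEquiv

lemma subsingleton_torFlip_succ_of_flat (M N : ModuleCat.{u} R) [Module.Flat R M] (n : ℕ) :
    Subsingleton ((torFlip N (n + 1)).obj M) := by
  have h₀ : ((projectiveResolution N).complex.sc (n + 1)).Exact :=
    (projectiveResolution N).complex_exactAt_succ n
  have h : ((tensorComplexFunctor (projectiveResolution N).complex).obj M).ExactAt (n + 1) := by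
    have := Module.Flat.lTensor_shortComplex_exact M _ h₀
    exact this
  exact ModuleCat.subsingleton_of_isZero h.isZero_homology

/-- The degree zero `Tor` is the tensor product. -/
def torZeroEquiv (M N : ModuleCat.{u} R) :
    ((Tor (ModuleCat.{u} R) 0).obj M).obj N ≃ₗ[R] TensorProduct R M N := by
  have : Limits.PreservesFiniteColimits ((tensoringLeft (ModuleCat.{u} R)).obj M) :=
    inferInstanceAs (Limits.PreservesFiniteColimits (tensorLeft M))
  exact (((tensoringLeft (ModuleCat.{u} R)).obj M).leftDerivedZeroIsoSelf.app N).toLinearEquiv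

/-- The long exact sequence of `Tor` in the first variable. -/
lemma exists_torFlip_long_exact {S : ShortComplex (ModuleCat.{u} R)} (hS : S.ShortExact)
    (N : ModuleCat.{u} R) :
    ∃ δ : ∀ n, (torFlip N (n + 1)).obj S.X₃ →ₗ[R] (torFlip N n).obj S.X₁,
      (∀ n, Function.Exact ((torFlip N n).map S.f) ((torFlip N n).map S.g)) ∧
      (∀ n, Function.Exact ((torFlip N (n + 1)).map S.g) (δ n)) ∧
      (∀ n, Function.Exact (δ n) ((torFlip N n).map S.f)) ∧
      Function.Surjective ((torFlip N 0).map S.g) := by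
  have hT := tensorComplexFunctor_shortExact (projectiveResolution N) hS
  refine ⟨fun n => (hT.δ (n + 1) n rfl).hom, fun n => ?_, fun n => ?_, fun n => ?_, ?_⟩
  · exact (ShortComplex.ShortExact.moduleCat_exact_iff_function_exact _).mp (hT.homology_exact₂ n)
  · exact (ShortComplex.ShortExact.moduleCat_exact_iff_function_exact _).mp
      (hT.homology_exact₃ (n + 1) n rfl)
  · exact (ShortComplex.ShortExact.moduleCat_exact_iff_function_exact _).mp
      (hT.homology_exact₁ (n + 1) n rfl)
  · rw [← ModuleCat.epi_iff_surjective]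
    have : Epi ((tensorComplexFunctor (projectiveResolution N).complex).map S.g) := hT.epi_g
    exact HomologicalComplex.epi_homologyMap_of_epi_of_not_rel
      ((tensorComplexFunctor (projectiveResolution N).complex).map S.g) 0 (by simp)

/-- Additive functors between module categories commute with finite powers. -/
def additivePiEquiv (F : ModuleCat.{u} R ⥤ ModuleCat.{u} R) [F.Additive] (M : Type u)
    [AddCommGroup M] [Module R M] (ι : Type) [Fintype ι] [DecidableEq ι] :
    F.obj (ModuleCat.of R (ι → M)) ≃ₗ[R] (ι → F.obj (ModuleCat.of R M)) :=
  LinearEquiv.ofLinearMap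
    (LinearMap.pi fun i => (F.map (ModuleCat.ofHom (LinearMap.proj i))).hom)
    (∑ i, (F.map (ModuleCat.ofHom (LinearMap.single R (fun _ => M) i))).hom ∘ₗ
      LinearMap.proj i)
    (by
      have h (i j : ι) : F.map (ModuleCat.ofHom (LinearMap.single R (fun _ => M) i)) ≫
          F.map (ModuleCat.ofHom (LinearMap.proj j)) = if i = j then 𝟙 _ else 0 := by
        rw [← F.map_comp, ← F.map_id, ← F.map_zero, ← apply_ite]
        congr 1
        ext x
        split_ifs with hij
        · subst hij; simp
        · simp [hij]
      ext i x j
      have := congr(ModuleCat.Hom.hom $(h i j) x)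
      simp only [ModuleCat.hom_comp, LinearMap.comp_apply] at this
      simp only [LinearMap.comp_apply, LinearMap.pi_apply, LinearMap.sum_apply,
        LinearMap.proj_apply, LinearMap.id_apply, LinearMap.single_apply, Pi.single_apply]
      rw [Finset.sum_eq_single i (by simp +contextual) (by simp), if_pos rfl, this]
      by_cases hij : i = j
      · simp [hij]
      · simp [hij, Ne.symm hij])
    (by
      have h : ∑ i, ModuleCat.ofHom (LinearMap.proj (R := R) (φ := fun _ : ι => M) i) ≫
          ModuleCat.ofHom (LinearMap.single R (fun _ => M) i) = 𝟙 (ModuleCat.of R (ι → M)) := by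
        ext x j
        simp [ModuleCat.hom_sum, Pi.single_apply]
      have := congr(ModuleCat.Hom.hom (F.map $h))
      rw [Functor.map_sum] at this
      ext x
      simpa [ModuleCat.hom_sum, LinearMap.sum_apply] using congr($this x))

/-- `Tor` commutes with finite powers in the first variable. -/
def torFlipPiEquiv (N : ModuleCat.{u} R) (n : ℕ) (M : Type u) [AddCommGroup M] [Module R M]
    (ι : Type) [Fintype ι] [DecidableEq ι] :
    (torFlip N n).obj (ModuleCat.of R (ι → M)) ≃ₗ[R]
      (ι → (torFlip N n).obj (ModuleCat.of R M)) :=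
  additivePiEquiv (torFlip N n) M ι

end Tor

section Polynomial

variable {K : Type*} [Field K]

lemma X_dvd_sub_aeval_of_forall_X_dvd {σ R : Type*} [CommRing R] (a : MvPolynomial σ R)
    (v : σ → MvPolynomial σ R) (hv : ∀ i, a ∣ X i - v i) (f : MvPolynomial σ R) :
    a ∣ f - aeval v f := by
  induction f using MvPolynomial.induction_on with
  | C c => simp [MvPolynomial.algebraMap_eq]
  | add f g hf hg =>
    rw [map_add, add_sub_add_comm]
    exact dvd_add hf hg
  | mul_X f i hf =>
    have : f * X i - aeval v (f * X i) = (f - aeval v f) * X i + aeval v f * (X i - v i) := by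
      simp; ring
    rw [this]
    exact dvd_add (hf.mul_right _) ((hv i).mul_left _)

lemma exists_cross_of_dot_X_eq_zero {a b c : MvPolynomial (Fin 3) K}
    (h : a * X 0 + b * X 1 + c * X 2 = 0) :
    ∃ u v w : MvPolynomial (Fin 3) K,
      a = v * X 2 - w * X 1 ∧ b = w * X 0 - u * X 2 ∧ c = u * X 1 - v * X 0 := by
  have hX (i : Fin 3) : (X i : MvPolynomial (Fin 3) K) ≠ 0 := X_ne_zero i
  let φ : MvPolynomial (Fin 3) K →ₐ[K] MvPolynomial (Fin 3) K :=
    aeval (fun i => if i = 0 then 0 else X i)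
  have hφ (f) : X 0 ∣ f - φ f := by
    apply X_dvd_sub_aeval_of_forall_X_dvd
    intro i
    split_ifs with hi <;> simp [hi]
  have h0 : φ b * X 1 + φ c * X 2 = 0 := by
    simpa [φ] using congr(φ $h)
  obtain ⟨d, hd⟩ : X 1 ∣ φ c := by
    have h1 : X 1 ∣ φ c * X 2 := ⟨-φ b, by linear_combination h0⟩
    refine ((X_prime (i := 1)).dvd_or_dvd h1).resolve_right fun h2 => ?_
    rw [X_dvd_X] at h2
    simp at h2
  have hb : φ b = - X 2 * d := by
    apply mul_right_cancel₀ (hX 1)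
    rw [hd] at h0
    linear_combination h0
  obtain ⟨b', hb'⟩ := hφ b
  obtain ⟨c', hc'⟩ := hφ c
  refine ⟨d, -c', b', ?_, ?_, ?_⟩
  · apply mul_right_cancel₀ (hX 0)
    linear_combination h - hb' * X 1 - hc' * X 2 - hb * X 1 - hd * X 2
  · linear_combination hb' + hb
  · linear_combination hc' + hd

lemma exists_eq_mul_X_of_cross_eq_zero {u v w : MvPolynomial (Fin 3) K}
    (h1 : w * X 0 = u * X 2) (h2 : u * X 1 = v * X 0) :
    ∃ r, u = r * X 0 ∧ v = r * X 1 ∧ w = r * X 2 := by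
  have hX (i : Fin 3) : (X i : MvPolynomial (Fin 3) K) ≠ 0 := X_ne_zero i
  obtain ⟨r, rfl⟩ : X 0 ∣ u := by
    have h3 : X 0 ∣ u * X 1 := ⟨v, by rw [h2, mul_comm]⟩
    refine ((X_prime (i := 0)).dvd_or_dvd h3).resolve_right fun h4 => ?_
    rw [X_dvd_X] at h4
    simp at h4
  refine ⟨r, mul_comm _ _, ?_, ?_⟩ <;> apply mul_right_cancel₀ (hX 0)
  · linear_combination -h2
  · linear_combination h1

end Polynomial

section Parity

variable {k}

/-- The `k`-algebra involution of `k[x, y, z]` sending each variable to its negative. -/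
def negVars : MvPolynomial (Fin 3) k →ₐ[k] MvPolynomial (Fin 3) k :=
  aeval fun i => -X i

@[simp]
lemma negVars_X (i : Fin 3) : negVars (X i : MvPolynomial (Fin 3) k) = -X i := by
  simp [negVars]

lemma X_mul_X_mem_Rv2 (i j : Fin 3) : (X i * X j : MvPolynomial (Fin 3) k) ∈ Rv2 k := by
  apply Algebra.subset_adjoin
  have h10 : (X 1 * X 0 : MvPolynomial (Fin 3) k) = X 0 * X 1 := mul_comm _ _
  have h20 : (X 2 * X 0 : MvPolynomial (Fin 3) k) = X 0 * X 2 := mul_comm _ _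
  have h21 : (X 2 * X 1 : MvPolynomial (Fin 3) k) = X 1 * X 2 := mul_comm _ _
  fin_cases i <;> fin_cases j <;> simp [sq, h10, h20, h21]

lemma X_mem_Av2 (i : Fin 3) : (X i : MvPolynomial (Fin 3) k) ∈ Av2 k := by
  apply Submodule.subset_span
  fin_cases i <;> simp

lemma X_mul_mem_Av2 (i : Fin 3) {f : MvPolynomial (Fin 3) k} (hf : f ∈ Rv2 k) :
    f * X i ∈ Av2 k :=
  (Av2 k).smul_mem ⟨f, hf⟩ (X_mem_Av2 i)

lemma mul_X_mem_Rv2 (i : Fin 3) {f : MvPolynomial (Fin 3) k} (hf : f ∈ Av2 k) :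
    f * X i ∈ Rv2 k := by
  induction hf using Submodule.span_induction with
  | mem x hx =>
    simp only [Set.mem_insert_iff, Set.mem_singleton_iff] at hx
    obtain rfl | rfl | rfl := hx <;> exact X_mul_X_mem_Rv2 _ _
  | zero => simp [zero_mem]
  | add x y _ _ hx hy => rw [add_mul]; exact add_mem hx hy
  | smul a x _ hx =>
    rw [Subalgebra.smul_def, smul_eq_mul, mul_assoc]; exact mul_mem a.2 hx

lemma negVars_of_mem_Rv2 {f : MvPolynomial (Fin 3) k} (hf : f ∈ Rv2 k) : negVars f = f := by
  have : Rv2 k ≤ AlgHom.equalizer negVars (AlgHom.id k _) := by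
    refine Algebra.adjoin_le ?_
    rintro x (rfl | rfl | rfl | rfl | rfl | rfl) <;> simp
  exact this hf

lemma negVars_of_mem_Av2 {f : MvPolynomial (Fin 3) k} (hf : f ∈ Av2 k) : negVars f = -f := by
  induction hf using Submodule.span_induction with
  | mem x hx =>
    simp only [Set.mem_insert_iff, Set.mem_singleton_iff] at hx
    obtain rfl | rfl | rfl := hx <;> simp
  | zero => simp
  | add x y _ _ hx hy => rw [map_add, hx, hy]; ring
  | smul a x _ hx =>
    rw [Subalgebra.smul_def, smul_eq_mul, map_mul, hx, negVars_of_mem_Rv2 a.2]; ring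

lemma exists_add_of_mem_Rv2_of_mem_Av2 (f : MvPolynomial (Fin 3) k) :
    ∃ r ∈ Rv2 k, ∃ a ∈ Av2 k, f = r + a := by
  induction f using MvPolynomial.induction_on with
  | C c => exact ⟨C c, (Rv2 k).algebraMap_mem c, 0, zero_mem _, by simp⟩
  | add f g hf hg =>
    obtain ⟨r, hr, a, ha, rfl⟩ := hf
    obtain ⟨s, hs, b, hb, rfl⟩ := hg
    exact ⟨r + s, add_mem hr hs, a + b, add_mem ha hb, by ring⟩
  | mul_X f i hf =>
    obtain ⟨r, hr, a, ha, rfl⟩ := hf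
    exact ⟨a * X i, mul_X_mem_Rv2 i ha, r * X i, X_mul_mem_Av2 i hr, by ring⟩

variable [NeZero (2 : k)]

lemma eq_zero_of_eq_neg {f : MvPolynomial (Fin 3) k} (h : f = -f) : f = 0 := by
  have h2 : (C 2 : MvPolynomial (Fin 3) k) * f = 0 := by
    rw [map_ofNat]
    linear_combination h
  exact (mul_eq_zero.mp h2).resolve_left (C_ne_zero.mpr two_ne_zero)

lemma mem_Rv2_iff {f : MvPolynomial (Fin 3) k} : f ∈ Rv2 k ↔ negVars f = f := by
  refine ⟨negVars_of_mem_Rv2, fun h => ?_⟩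
  obtain ⟨r, hr, a, ha, rfl⟩ := exists_add_of_mem_Rv2_of_mem_Av2 f
  rw [map_add, negVars_of_mem_Rv2 hr, negVars_of_mem_Av2 ha] at h
  rwa [eq_zero_of_eq_neg (add_left_cancel h.symm), add_zero]

end Parity

section Sequences

variable {k}

lemma pV2_apply (f : Fin 3 → Rv2 k) :
    pV2 k f = (f 0 : MvPolynomial (Fin 3) k) * X 0 + (f 1 : MvPolynomial (Fin 3) k) * X 1 +
      (f 2 : MvPolynomial (Fin 3) k) * X 2 := by
  simp [pV2, Fin.sum_univ_three, Subalgebra.smul_def]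

lemma pV2_mem_Av2 (f : Fin 3 → Rv2 k) : pV2 k f ∈ Av2 k := by
  rw [pV2_apply]
  exact add_mem (add_mem (X_mul_mem_Av2 0 (f 0).2) (X_mul_mem_Av2 1 (f 1).2))
    (X_mul_mem_Av2 2 (f 2).2)

/-- The variable `X i` as an element of `A`. -/
def varAv2 (i : Fin 3) : Av2 k := ⟨X i, X_mem_Av2 i⟩

/-- The surjection `R³ → A` with kernel `B`. -/
def coverAv2 : (Fin 3 → Rv2 k) →ₗ[Rv2 k] Av2 k :=
  (pV2 k).codRestrict (Av2 k) pV2_mem_Av2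

lemma coverAv2_eq_sum (f : Fin 3 → Rv2 k) : coverAv2 f = ∑ i, f i • varAv2 i := by
  ext1
  simp [coverAv2, pV2_apply, Fin.sum_univ_three, Subalgebra.smul_def, varAv2]

lemma span_varAv2 : Submodule.span (Rv2 k) (Set.range (varAv2 (k := k))) = ⊤ := by
  apply Submodule.map_injective_of_injective (Av2 k).injective_subtype
  rw [Submodule.map_span, Submodule.map_top, Submodule.range_subtype, ← Set.range_comp]
  change _ = Submodule.span _ {X 0, X 1, X 2}
  congr 1
  ext x
  simp [varAv2, Fin.exists_fin_succ, eq_comm]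

lemma coverAv2_surjective : Function.Surjective (coverAv2 (k := k)) := by
  intro a
  have ha : a ∈ Submodule.span (Rv2 k) (Set.range (varAv2 (k := k))) := by simp [span_varAv2]
  obtain ⟨c, rfl⟩ := (Submodule.mem_span_range_iff_exists_fun _).mp ha
  exact ⟨c, coverAv2_eq_sum c⟩

lemma exact_subtype_coverAv2 : Function.Exact (Bv2 k).subtype (coverAv2 (k := k)) := by
  rw [LinearMap.exact_iff, Submodule.range_subtype, coverAv2, LinearMap.ker_codRestrict, Bv2]

/-- The product of a variable with an element of `A`, as an element of `R`. -/
def mulVarV2 (i : Fin 3) : Av2 k →ₗ[Rv2 k] Rv2 k where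
  toFun a := ⟨(a : MvPolynomial (Fin 3) k) * X i, mul_X_mem_Rv2 i a.2⟩
  map_add' a b := by ext1; simp [add_mul]
  map_smul' r a := by ext1; simp [Subalgebra.smul_def, mul_assoc]

@[simp]
lemma coe_mulVarV2 (i : Fin 3) (a : Av2 k) :
    (mulVarV2 i a : MvPolynomial (Fin 3) k) = (a : MvPolynomial (Fin 3) k) * X i := rfl

/-- The cross product with `(x, y, z)`, as a map `A³ → R³`. -/
def crossFunV2 : (Fin 3 → Av2 k) →ₗ[Rv2 k] (Fin 3 → Rv2 k) :=
  LinearMap.pi ![mulVarV2 2 ∘ₗ LinearMap.proj 1 - mulVarV2 1 ∘ₗ LinearMap.proj 2,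
    mulVarV2 0 ∘ₗ LinearMap.proj 2 - mulVarV2 2 ∘ₗ LinearMap.proj 0,
    mulVarV2 1 ∘ₗ LinearMap.proj 0 - mulVarV2 0 ∘ₗ LinearMap.proj 1]

lemma crossFunV2_mem_Bv2 (u : Fin 3 → Av2 k) : crossFunV2 u ∈ Bv2 k := by
  rw [Bv2, LinearMap.mem_ker, pV2_apply]
  simp [crossFunV2]
  ring

/-- The cross product with `(x, y, z)`, as a map `A³ → B`. -/
def crossV2 : (Fin 3 → Av2 k) →ₗ[Rv2 k] Bv2 k :=
  crossFunV2.codRestrict (Bv2 k) crossFunV2_mem_Bv2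

/-- The inclusion `R → A³` sending `1` to `(x, y, z)`. -/
def diagV2 : Rv2 k →ₗ[Rv2 k] (Fin 3 → Av2 k) :=
  LinearMap.toSpanSingleton _ _ varAv2

lemma diagV2_injective : Function.Injective (diagV2 (k := k)) := by
  rw [injective_iff_map_eq_zero]
  intro r hr
  have h : (r : MvPolynomial (Fin 3) k) * X 0 = 0 := by
    simpa [diagV2, varAv2, Subalgebra.smul_def] using
      congr((($hr : Fin 3 → Av2 k) 0 : MvPolynomial (Fin 3) k))
  ext1
  exact (mul_eq_zero.mp h).resolve_right (X_ne_zero 0)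

lemma crossV2_eq_iff (u : Fin 3 → Av2 k) (f : Bv2 k) : crossV2 u = f ↔
    (u 1 : MvPolynomial (Fin 3) k) * X 2 -
      (u 2 : MvPolynomial (Fin 3) k) * X 1 = (f.1 0 : MvPolynomial (Fin 3) k) ∧
    (u 2 : MvPolynomial (Fin 3) k) * X 0 -
      (u 0 : MvPolynomial (Fin 3) k) * X 2 = (f.1 1 : MvPolynomial (Fin 3) k) ∧
    (u 0 : MvPolynomial (Fin 3) k) * X 1 -
      (u 1 : MvPolynomial (Fin 3) k) * X 0 = (f.1 2 : MvPolynomial (Fin 3) k) := by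
  rw [Subtype.ext_iff, _root_.funext_iff, Fin.forall_fin_succ, Fin.forall_fin_two]
  simp [crossV2, crossFunV2, Subtype.ext_iff]

lemma sum_crossV2_single : ∑ i : Fin 3, crossV2 (Pi.single i (varAv2 (k := k) i)) = 0 := by
  rw [← map_sum, crossV2_eq_iff]
  simp [varAv2]
  refine ⟨by ring, by ring, by ring⟩

variable [NeZero (2 : k)]

lemma exact_diagV2_crossV2 : Function.Exact (diagV2 (k := k)) crossV2 := by
  intro u
  rw [crossV2_eq_iff]
  simp only [ZeroMemClass.coe_zero, Pi.zero_apply, sub_eq_zero]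
  constructor
  · rintro ⟨h0, h1, h2⟩
    obtain ⟨r, hr0, hr1, hr2⟩ := exists_eq_mul_X_of_cross_eq_zero h1 h2
    have hr : r ∈ Rv2 k := by
      rw [mem_Rv2_iff]
      have := negVars_of_mem_Av2 (u 0).2
      rw [hr0, map_mul, negVars_X] at this
      apply mul_right_cancel₀ (X_ne_zero (R := k) (0 : Fin 3))
      linear_combination -this
    refine ⟨⟨r, hr⟩, ?_⟩
    rw [_root_.funext_iff, Fin.forall_fin_succ, Fin.forall_fin_two]
    simp [diagV2, varAv2, Subtype.ext_iff, Subalgebra.smul_def, hr0, hr1, hr2]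
  · rintro ⟨r, rfl⟩
    simp only [diagV2, varAv2, LinearMap.toSpanSingleton_apply, Pi.smul_apply,
      Submodule.coe_smul, Subalgebra.smul_def, smul_eq_mul]
    refine ⟨by ring, by ring, by ring⟩

lemma crossV2_surjective : Function.Surjective (crossV2 (k := k)) := by
  intro f
  obtain ⟨f, hf⟩ := f
  have h := hf
  rw [Bv2, LinearMap.mem_ker, pV2_apply] at h
  obtain ⟨u, v, w, h0, h1, h2⟩ := exists_cross_of_dot_X_eq_zero h
  obtain ⟨u₀, hu₀, u₁, hu₁, rfl⟩ := exists_add_of_mem_Rv2_of_mem_Av2 u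
  obtain ⟨v₀, hv₀, v₁, hv₁, rfl⟩ := exists_add_of_mem_Rv2_of_mem_Av2 v
  obtain ⟨w₀, hw₀, w₁, hw₁, rfl⟩ := exists_add_of_mem_Rv2_of_mem_Av2 w
  refine ⟨![⟨u₁, hu₁⟩, ⟨v₁, hv₁⟩, ⟨w₁, hw₁⟩], (crossV2_eq_iff _ _).mpr ?_⟩
  have key {a b c d : MvPolynomial (Fin 3) k} (ha : a ∈ Rv2 k) (hb : b ∈ Av2 k)
      (hc : c ∈ Rv2 k) (hd : d ∈ Av2 k) (i j : Fin 3) (g : Rv2 k)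
      (hg : (g : MvPolynomial (Fin 3) k) = (a + b) * X i - (c + d) * X j) :
      b * X i - d * X j = (g : MvPolynomial (Fin 3) k) := by
    have hg' := negVars_of_mem_Rv2 g.2
    rw [hg] at hg' ⊢
    simp only [map_sub, map_mul, map_add, negVars_X, negVars_of_mem_Rv2 ha,
      negVars_of_mem_Rv2 hc, negVars_of_mem_Av2 hb, negVars_of_mem_Av2 hd] at hg'
    have h : a * X i - c * X j = 0 := eq_zero_of_eq_neg (by linear_combination -hg')
    linear_combination -h
  exact ⟨key hv₀ hv₁ hw₀ hw₁ 2 1 _ h0, key hw₀ hw₁ hu₀ hu₁ 0 2 _ h1,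
    key hu₀ hu₁ hv₀ hv₁ 1 0 _ h2⟩

end Sequences

section TensorQuotient

variable {R M : Type*} [CommRing R] [AddCommGroup M] [Module R M] {ι : Type*}

lemma exists_surjective_pi_to_tensorProduct [Fintype ι] (N : Type*) [AddCommGroup N] [Module R N]
    {v : ι → M}
    (hv : Submodule.span R (Set.range v) = ⊤) :
    ∃ ψ : (ι → N) →ₗ[R] TensorProduct R M N, Function.Surjective ψ := by
  classical
  let ψ : (ι → N) →ₗ[R] TensorProduct R M N :=
    ∑ i, TensorProduct.mk R M N (v i) ∘ₗ LinearMap.proj i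
  refine ⟨ψ, fun t => ?_⟩
  induction t using TensorProduct.induction_on with
  | zero => exact ⟨0, map_zero ψ⟩
  | add x y hx hy =>
    obtain ⟨a, rfl⟩ := hx
    obtain ⟨b, rfl⟩ := hy
    exact ⟨a + b, map_add ψ a b⟩
  | tmul m n =>
    have hm : m ∈ Submodule.span R (Set.range v) := by simp [hv]
    obtain ⟨c, rfl⟩ := (Submodule.mem_span_range_iff_exists_fun _).mp hm
    exact ⟨fun i => c i • n, by simp [ψ, TensorProduct.sum_tmul, TensorProduct.smul_tmul]⟩

lemma exists_surjective_tensorProduct_quotient_to_pi {I : Ideal R} {φ : M →ₗ[R] (ι → R ⧸ I)}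
    (hφ : Function.Surjective φ) :
    ∃ ψ : TensorProduct R M (R ⧸ I) →ₗ[R] (ι → R ⧸ I), Function.Surjective ψ := by
  refine ⟨TensorProduct.lift (LinearMap.mk₂ R (fun m c i => c * φ m i) ?_ ?_ ?_ ?_), fun x => ?_⟩
  · intros; ext; simp [mul_add]
  · intros; ext; simp
  · intros; ext; simp [add_mul]
  · intros; ext; simp
  · obtain ⟨m, rfl⟩ := hφ x
    exact ⟨m ⊗ₜ[R] 1, by ext; simp⟩

end TensorQuotient

section TorResidue

open scoped ModuleCat

variable {k R : Type} [Field k] [CommRing R] [Algebra k R] {I : Ideal R}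
variable {A B C M : Type} [AddCommGroup A] [Module R A] [AddCommGroup B] [Module R B]
  [AddCommGroup C] [Module R C] [AddCommGroup M] [Module R M] {ι : Type}

lemma surjective_pi_quotient_of_eq_single [Fintype ι] [DecidableEq ι] {φ : M →ₗ[R] (ι → R ⧸ I)}
    {v : ι → M} (h : ∀ i, φ (v i) = Pi.single i 1) : Function.Surjective φ := by
  intro x
  choose r hr using fun i => Ideal.Quotient.mk_surjective (x i)
  refine ⟨∑ i, r i • v i, ?_⟩
  ext i
  simp only [map_sum, map_smul, h, Finset.sum_apply, Pi.smul_apply, Pi.single_apply, smul_ite,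
    smul_zero, Finset.sum_ite_eq, Finset.mem_univ, if_true]
  rw [← hr i, ← Algebra.algebraMap_eq_smul_one, Ideal.Quotient.algebraMap_eq]

lemma exists_span_eq_top_of_sum_single_eq_zero {v : Fin 3 → A}
    (hv : Submodule.span R (Set.range v) = ⊤) {c : (Fin 3 → A) →ₗ[R] B}
    (hc : Function.Surjective c) (h : ∑ i, c (Pi.single i (v i)) = 0) :
    ∃ w : {p : Fin 3 × Fin 3 // p ≠ 0} → B, Submodule.span R (Set.range w) = ⊤ := by
  let w (p : Fin 3 × Fin 3) : B := c (Pi.single p.1 (v p.2))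
  refine ⟨fun p => w p, ?_⟩
  set P := Submodule.span R (Set.range fun p : {p : Fin 3 × Fin 3 // p ≠ 0} => w p)
  have hw (p) (hp : p ≠ 0) : w p ∈ P := Submodule.subset_span ⟨⟨p, hp⟩, rfl⟩
  have hw0 : w (0, 0) ∈ P := by
    rw [Fin.sum_univ_three, add_assoc] at h
    have h' : w (0, 0) = -(w (1, 1) + w (2, 2)) := eq_neg_of_add_eq_zero_left h
    rw [h']
    exact neg_mem (add_mem (hw _ (by simp)) (hw _ (by simp)))
  have hw' (p) : w p ∈ P := by
    by_cases hp : p = 0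
    · exact hp ▸ hw0
    · exact hw p hp
  rw [eq_top_iff]
  rintro b -
  obtain ⟨u, rfl⟩ := hc b
  rw [← Finset.univ_sum_single u, map_sum]
  refine sum_mem fun i _ => ?_
  have hu : u i ∈ Submodule.span R (Set.range v) := hv ▸ Submodule.mem_top
  obtain ⟨a, ha⟩ := (Submodule.mem_span_range_iff_exists_fun _).mp hu
  rw [← ha, ← LinearMap.single_apply (R := R) (φ := fun _ => A), map_sum, map_sum]
  refine sum_mem fun j _ => ?_
  rw [map_smul, map_smul]
  exact P.smul_mem _ (hw' (i, j))

variable (I) in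
/-- `Tor` in degree `n` against the quotient ring by an ideal. -/
abbrev torQuotient (n : ℕ) (M : Type) [AddCommGroup M] [Module R M] : ModuleCat R :=
  (torFlip (ModuleCat.of R (R ⧸ I)) n).obj (ModuleCat.of R M)

lemma finrank_restrictScalars_tor (n : ℕ) (M : Type) [AddCommGroup M] [Module R M] :
    Module.finrank k (RestrictScalars k R
      (((Tor (ModuleCat R) n).obj (ModuleCat.of R M)).obj (ModuleCat.of R (R ⧸ I)))) =
    Module.finrank k (torQuotient I n M) :=
  ((torEquivTorFlip (ModuleCat.of R M) (ModuleCat.of R (R ⧸ I)) n).restrictScalars k).finrank_eq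

variable (I M) in
/-- The degree zero `Tor` is the tensor product with the quotient. -/
def torQuotientZeroEquiv : TensorProduct R M (R ⧸ I) ≃ₗ[R] torQuotient I 0 M :=
  (torZeroEquiv (ModuleCat.of R M) (ModuleCat.of R (R ⧸ I))).symm.trans
    (torEquivTorFlip (ModuleCat.of R M) (ModuleCat.of R (R ⧸ I)) 0)

lemma finite_and_finrank_torQuotient_zero_le [Fintype ι] (hI : Module.finrank k (R ⧸ I) = 1)
    {v : ι → M} (hv : Submodule.span R (Set.range v) = ⊤) :
    Module.Finite k (torQuotient I 0 M) ∧
      Module.finrank k (torQuotient I 0 M) ≤ Fintype.card ι := by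
  obtain ⟨ψ, hψ⟩ := exists_surjective_pi_to_tensorProduct (R ⧸ I) hv
  have : Module.Finite k (R ⧸ I) :=
    Module.finite_of_finrank_pos (by rw [hI]; exact one_pos)
  let χ : (ι → R ⧸ I) →ₗ[k] torQuotient I 0 M :=
    ((torQuotientZeroEquiv I M).toLinearMap ∘ₗ ψ).restrictScalars k
  have hχ : Function.Surjective χ := (torQuotientZeroEquiv I M).surjective.comp hψ
  refine ⟨Module.Finite.of_surjective χ hχ, ?_⟩
  simpa [Module.finrank_pi_fintype, hI] using LinearMap.finrank_le_finrank_of_surjective hχ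

lemma le_finrank_torQuotient_zero [Fintype ι] (hI : Module.finrank k (R ⧸ I) = 1)
    {φ : M →ₗ[R] (ι → R ⧸ I)} (hφ : Function.Surjective φ)
    [Module.Finite k (torQuotient I 0 M)] :
    Fintype.card ι ≤ Module.finrank k (torQuotient I 0 M) := by
  obtain ⟨ψ, hψ⟩ := exists_surjective_tensorProduct_quotient_to_pi hφ
  have : Module.Finite k (R ⧸ I) :=
    Module.finite_of_finrank_pos (by rw [hI]; exact one_pos)
  let χ : torQuotient I 0 M →ₗ[k] (ι → R ⧸ I) :=
    (ψ ∘ₗ (torQuotientZeroEquiv I M).symm.toLinearMap).restrictScalars k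
  have hχ : Function.Surjective χ := hψ.comp (torQuotientZeroEquiv I M).symm.surjective
  simpa [Module.finrank_pi_fintype, hI] using LinearMap.finrank_le_finrank_of_surjective hχ

/-- `Tor` commutes with finite powers, as `k`-vector spaces. -/
def torQuotientPiEquiv (n : ℕ) (M : Type) [AddCommGroup M] [Module R M] (m : ℕ) :
    torQuotient I n (Fin m → M) ≃ₗ[k] (Fin m → torQuotient I n M) :=
  LinearEquiv.restrictScalars k (torFlipPiEquiv (ModuleCat.of R (R ⧸ I)) n M (Fin m))

lemma finrank_torQuotient_pi (n : ℕ) (M : Type) [AddCommGroup M] [Module R M] (m : ℕ)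
    [Module.Finite k (torQuotient I n M)] :
    Module.finrank k (torQuotient I n (Fin m → M)) =
      m * Module.finrank k (torQuotient I n M) := by
  rw [(torQuotientPiEquiv (k := k) n M m).finrank_eq]
  simp [Module.finrank_pi_fintype]

lemma finite_torQuotient_pi (n : ℕ) (M : Type) [AddCommGroup M] [Module R M] (m : ℕ)
    [Module.Finite k (torQuotient I n M)] : Module.Finite k (torQuotient I n (Fin m → M)) :=
  Module.Finite.equiv (torQuotientPiEquiv n M m).symm

variable (k I) in
lemma exists_torQuotient_long_exact {f : A →ₗ[R] B} {g : B →ₗ[R] C} (hf : Function.Injective f)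
    (hfg : Function.Exact f g) (hg : Function.Surjective g) :
    ∃ (φ : ∀ n, torQuotient I n A →ₗ[k] torQuotient I n B)
      (γ : ∀ n, torQuotient I n B →ₗ[k] torQuotient I n C)
      (δ : ∀ n, torQuotient I (n + 1) C →ₗ[k] torQuotient I n A),
      (∀ n, Function.Exact (φ n) (γ n)) ∧ (∀ n, Function.Exact (γ (n + 1)) (δ n)) ∧
      (∀ n, Function.Exact (δ n) (φ n)) ∧ Function.Surjective (γ 0) := by
  let S : ShortComplex (ModuleCat R) :=
    ShortComplex.mk (ModuleCat.ofHom f) (ModuleCat.ofHom g)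
      (by ext x; exact hfg.apply_apply_eq_zero x)
  have hS : S.ShortExact :=
    { exact := (ShortComplex.ShortExact.moduleCat_exact_iff_function_exact S).mpr hfg
      mono_f := (ModuleCat.mono_iff_injective _).mpr hf
      epi_g := (ModuleCat.epi_iff_surjective _).mpr hg }
  obtain ⟨δ, h⟩ := exists_torFlip_long_exact hS (ModuleCat.of R (R ⧸ I))
  exact ⟨fun n => ((torFlip (ModuleCat.of R (R ⧸ I)) n).map S.f).hom.restrictScalars k,
    fun n => ((torFlip (ModuleCat.of R (R ⧸ I)) n).map S.g).hom.restrictScalars k,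
    fun n => (δ n).restrictScalars k, h⟩

lemma subsingleton_torQuotient_succ [Module.Flat R M] (n : ℕ) :
    Subsingleton (torQuotient I (n + 1) M) :=
  subsingleton_torFlip_succ_of_flat _ _ n

lemma finite_and_finrank_torQuotient_zero_pi (hI : Module.finrank k (R ⧸ I) = 1) (m : ℕ) :
    Module.Finite k (torQuotient I 0 (Fin m → R)) ∧
      Module.finrank k (torQuotient I 0 (Fin m → R)) = m := by
  have h := finite_and_finrank_torQuotient_zero_le hI (Pi.basisFun R (Fin m)).span_eq
  have := h.1
  refine ⟨h.1, le_antisymm (by simpa using h.2) ?_⟩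
  have hφ : Function.Surjective (I.mkQ.compLeft (Fin m)) := I.mkQ_surjective.comp_left
  simpa using le_finrank_torQuotient_zero hI hφ

lemma finite_and_finrank_torQuotient_zero_self (hI : Module.finrank k (R ⧸ I) = 1) :
    Module.Finite k (torQuotient I 0 R) ∧ Module.finrank k (torQuotient I 0 R) ≤ 1 := by
  have h : Submodule.span R (Set.range fun _ : Unit => (1 : R)) = ⊤ := by
    simp
  simpa using finite_and_finrank_torQuotient_zero_le hI h

/-- Dimension shifting along a minimal free cover. -/
lemma finrank_torQuotient_succ_eq (hI : Module.finrank k (R ⧸ I) = 1) {m : ℕ}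
    {f : B →ₗ[R] (Fin m → R)} {g : (Fin m → R) →ₗ[R] A} (hf : Function.Injective f)
    (hfg : Function.Exact f g) (hg : Function.Surjective g)
    [Module.Finite k (torQuotient I 0 A)] (hA : Module.finrank k (torQuotient I 0 A) = m) (n : ℕ) :
    Module.finrank k (torQuotient I (n + 1) A) = Module.finrank k (torQuotient I n B) := by
  obtain ⟨φ, γ, δ, hφγ, hγδ, hδφ, hγ⟩ := exists_torQuotient_long_exact k I hf hfg hg
  have hsub (n) := subsingleton_torQuotient_succ (M := Fin m → R) (I := I) n
  have hinj : Function.Injective (δ n) := by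
    rw [injective_iff_map_eq_zero]
    intro x hx
    obtain ⟨y, rfl⟩ := (hγδ n x).mp hx
    rw [Subsingleton.elim y 0, map_zero]
  have hzero (x) : φ n x = 0 := by
    cases n with
    | zero =>
      obtain ⟨_, hm⟩ := finite_and_finrank_torQuotient_zero_pi hI m
      have hi : Function.Injective (γ 0) :=
        (LinearMap.injective_iff_surjective_of_finrank_eq_finrank (hm.trans hA.symm)).mpr hγ
      exact hi (by rw [(hφγ 0).apply_apply_eq_zero, map_zero])
    | succ n => exact Subsingleton.elim _ _
  exact (LinearEquiv.ofBijective (δ n)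
    ⟨hinj, fun x => (hδφ n x).mp (hzero x)⟩).finrank_eq

section Exact

variable {f : R →ₗ[R] (Fin 3 → A)} {g : (Fin 3 → A) →ₗ[R] B}

lemma finrank_torQuotient_zero_eq_eight (hI : Module.finrank k (R ⧸ I) = 1)
    (hf : Function.Injective f) (hfg : Function.Exact f g) (hg : Function.Surjective g)
    [Module.Finite k (torQuotient I 0 A)] (hA : Module.finrank k (torQuotient I 0 A) = 3)
    {v : Fin 3 → A} (hv : Submodule.span R (Set.range v) = ⊤)
    (hgv : ∑ i, g (Pi.single i (v i)) = 0) :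
    Module.finrank k (torQuotient I 0 B) = 8 := by
  obtain ⟨w, hw⟩ := exists_span_eq_top_of_sum_single_eq_zero hv hg hgv
  obtain ⟨_, hle⟩ := finite_and_finrank_torQuotient_zero_le hI hw
  refine le_antisymm (by simpa using hle) ?_
  obtain ⟨φ, γ, δ, hφγ, hγδ, hδφ, hγ⟩ := exists_torQuotient_long_exact k I hf hfg hg
  obtain ⟨_, hR⟩ := finite_and_finrank_torQuotient_zero_self hI
  have := finite_torQuotient_pi (k := k) (I := I) 0 A 3
  have hA3 := finrank_torQuotient_pi (k := k) (I := I) 0 A 3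
  rw [hA] at hA3
  have hrank := (γ 0).finrank_range_add_finrank_ker
  rw [(hφγ 0).linearMap_ker_eq, LinearMap.range_eq_top.mpr hγ, finrank_top] at hrank
  have := (φ 0).finrank_range_le
  lia

lemma finrank_torQuotient_succ_eq_three_mul (hI : Module.finrank k (R ⧸ I) = 1)
    (hf : Function.Injective f) (hfg : Function.Exact f g) (hg : Function.Surjective g)
    [Module.Finite k (torQuotient I 0 A)] (hA : Module.finrank k (torQuotient I 0 A) = 3)
    (hB : Module.finrank k (torQuotient I 0 B) = 8) (n : ℕ)
    [Module.Finite k (torQuotient I (n + 1) A)] :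
    Module.finrank k (torQuotient I (n + 1) B) =
      3 * Module.finrank k (torQuotient I (n + 1) A) := by
  obtain ⟨φ, γ, δ, hφγ, hγδ, hδφ, hγ⟩ := exists_torQuotient_long_exact k I hf hfg hg
  have hsub (n) := subsingleton_torQuotient_succ (M := R) (I := I) n
  have hinj : Function.Injective (γ (n + 1)) := by
    rw [injective_iff_map_eq_zero]
    intro x hx
    obtain ⟨y, rfl⟩ := (hφγ (n + 1) x).mp hx
    rw [Subsingleton.elim y 0, map_zero]
  have hzero (x) : δ n x = 0 := by
    cases n with
    | zero =>
      obtain ⟨_, hR⟩ := finite_and_finrank_torQuotient_zero_self hI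
      have := finite_torQuotient_pi (k := k) (I := I) 0 A 3
      have hA3 := finrank_torQuotient_pi (k := k) (I := I) 0 A 3
      rw [hA] at hA3
      have hrank := (γ 0).finrank_range_add_finrank_ker
      rw [(hφγ 0).linearMap_ker_eq, LinearMap.range_eq_top.mpr hγ, finrank_top, hB] at hrank
      have hrank' := (φ 0).finrank_range_add_finrank_ker
      have hker : LinearMap.ker (φ 0) = ⊥ := Submodule.finrank_eq_zero.mp (by lia)
      exact LinearMap.ker_eq_bot.mp hker
        (by rw [(hδφ 0).apply_apply_eq_zero, map_zero])
    | succ n => exact Subsingleton.elim _ _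
  rw [← finrank_torQuotient_pi]
  exact (LinearEquiv.ofBijective (γ (n + 1))
    ⟨hinj, fun x => (hγδ n x).mp (hzero x)⟩).finrank_eq.symm

/-- The Betti numbers of modules `A` and `B` with minimal generators `v` of `A` and exact sequences
`0 → B → R³ → A → 0` and `0 → R → A³ → B → 0`, the second of which yields the relation
`∑ i, g (Pi.single i (v i)) = 0`. -/
theorem finrank_tor_eq_of_exact (hI : Module.finrank k (R ⧸ I) = 1) {v : Fin 3 → A}
    (hv : Submodule.span R (Set.range v) = ⊤) {ψ : A →ₗ[R] (Fin 3 → R ⧸ I)}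
    (hψ : ∀ i, ψ (v i) = Pi.single i 1)
    {s : B →ₗ[R] (Fin 3 → R)} {q : (Fin 3 → R) →ₗ[R] A} (hs : Function.Injective s)
    (hsq : Function.Exact s q) (hq : Function.Surjective q)
    (hf : Function.Injective f) (hfg : Function.Exact f g) (hg : Function.Surjective g)
    (hgv : ∑ i, g (Pi.single i (v i)) = 0) :
    (Module.finrank k (RestrictScalars k R
      (((Tor (ModuleCat R) 0).obj (ModuleCat.of R A)).obj (ModuleCat.of R (R ⧸ I)))) = 3 ∧
    ∀ n, 1 ≤ n → Module.finrank k (RestrictScalars k R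
      (((Tor (ModuleCat R) n).obj (ModuleCat.of R A)).obj (ModuleCat.of R (R ⧸ I)))) =
        8 * 3 ^ (n - 1)) ∧
    ∀ n, Module.finrank k (RestrictScalars k R
      (((Tor (ModuleCat R) n).obj (ModuleCat.of R B)).obj (ModuleCat.of R (R ⧸ I)))) =
        8 * 3 ^ n := by
  simp only [finrank_restrictScalars_tor]
  obtain ⟨_, hle⟩ := finite_and_finrank_torQuotient_zero_le hI hv
  have hA : Module.finrank k (torQuotient I 0 A) = 3 :=
    le_antisymm hle (le_finrank_torQuotient_zero hI (surjective_pi_quotient_of_eq_single hψ))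
  have hB₀ := finrank_torQuotient_zero_eq_eight hI hf hfg hg hA hv hgv
  have hAB := finrank_torQuotient_succ_eq hI hs hsq hq hA
  have hB (n) : Module.finrank k (torQuotient I n B) = 8 * 3 ^ n := by
    induction n with
    | zero => simp [hB₀]
    | succ n ih =>
      have h := (hAB n).trans ih
      have : Module.Finite k (torQuotient I (n + 1) A) :=
        Module.finite_of_finrank_pos (by rw [h]; positivity)
      rw [finrank_torQuotient_succ_eq_three_mul hI hf hfg hg hA hB₀, h]
      ring
  refine ⟨⟨hA, fun n hn => ?_⟩, hB⟩
  obtain ⟨n, rfl⟩ := Nat.exists_eq_add_of_le' hn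
  rw [hAB, hB, Nat.add_sub_cancel]

end Exact

end TorResidue

section Residue

variable {k}

lemma mk_eq_algebraMap_constantCoeff (r : Rv2 k) : (Ideal.Quotient.mk (mV2 k) r) =
    algebraMap k (Rv2 k ⧸ mV2 k) (constantCoeff (r : MvPolynomial (Fin 3) k)) := by
  rw [IsScalarTower.algebraMap_apply k (Rv2 k) (Rv2 k ⧸ mV2 k), Ideal.Quotient.algebraMap_eq,
    Ideal.Quotient.eq]
  simp [mV2, RingHom.mem_ker, MvPolynomial.algebraMap_eq]

lemma smul_residue (r : Rv2 k) (q : Rv2 k ⧸ mV2 k) : r • q =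
    algebraMap k (Rv2 k ⧸ mV2 k) (constantCoeff (r : MvPolynomial (Fin 3) k)) * q := by
  rw [Algebra.smul_def r q, Ideal.Quotient.algebraMap_eq, mk_eq_algebraMap_constantCoeff]

lemma one_notMem_mV2 : (1 : Rv2 k) ∉ mV2 k := by
  simp [mV2, RingHom.mem_ker]

lemma finrank_residue : Module.finrank k (Rv2 k ⧸ mV2 k) = 1 := by
  refine finrank_eq_one (Ideal.Quotient.mk _ 1) ?_ fun w => ?_
  · rw [Ne, Ideal.Quotient.eq_zero_iff_mem]
    exact one_notMem_mV2
  · obtain ⟨r, rfl⟩ := Ideal.Quotient.mk_surjective w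
    exact ⟨constantCoeff (r : MvPolynomial (Fin 3) k), by
      rw [mk_eq_algebraMap_constantCoeff r, map_one, Algebra.algebraMap_eq_smul_one]⟩

lemma constantCoeff_of_mem_Av2 {f : MvPolynomial (Fin 3) k} (hf : f ∈ Av2 k) :
    constantCoeff f = 0 := by
  induction hf using Submodule.span_induction with
  | mem x hx =>
    simp only [Set.mem_insert_iff, Set.mem_singleton_iff] at hx
    obtain rfl | rfl | rfl := hx <;> simp
  | zero => simp
  | add x y _ _ hx hy => simp [hx, hy]
  | smul a x _ hx => simp [Subalgebra.smul_def, hx]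

/-- The linear coefficients of an element of `A`, as elements of the residue field. -/
def linearCoeffsAv2 : Av2 k →ₗ[Rv2 k] (Fin 3 → Rv2 k ⧸ mV2 k) where
  toFun f i := algebraMap k _ (constantCoeff (pderiv i (f : MvPolynomial (Fin 3) k)))
  map_add' f g := by ext; simp
  map_smul' r f := by
    ext i
    rw [RingHom.id_apply, Pi.smul_apply, smul_residue]
    simp [Subalgebra.smul_def, constantCoeff_of_mem_Av2 f.2]

lemma linearCoeffsAv2_varAv2 (i : Fin 3) :
    linearCoeffsAv2 (varAv2 (k := k) i) = Pi.single i 1 := by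
  ext j
  by_cases h : i = j
  · simp [linearCoeffsAv2, varAv2, h]
  · simp [linearCoeffsAv2, varAv2, pderiv_X, h, Ne.symm h]

end Residue

theorem betti_veronese2_modules (p : ℕ) [Fact p.Prime] (k : Type) [Field k] [IsAlgClosed k]
    [CharP k p] (hp : 2 < p) :
    (bettiV2 k 0 ↥(Av2 k) = 3 ∧
      ∀ i : ℕ, 1 ≤ i → bettiV2 k i ↥(Av2 k) = 8 * 3 ^ (i - 1)) ∧
    (∀ i : ℕ, bettiV2 k i ↥(Bv2 k) = 8 * 3 ^ i) := by
  have : NeZero (2 : k) := by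
    refine ⟨fun h => ?_⟩
    have h2 : ((2 : ℕ) : k) = 0 := by exact_mod_cast h
    exact absurd (Nat.le_of_dvd two_pos ((CharP.cast_eq_zero_iff k p 2).mp h2)) (by lia)
  exact finrank_tor_eq_of_exact (R := Rv2 k) (I := mV2 k) (A := Av2 k) (B := Bv2 k)
    finrank_residue span_varAv2 linearCoeffsAv2_varAv2 (Bv2 k).injective_subtype
    exact_subtype_coverAv2 coverAv2_surjective diagV2_injective exact_diagV2_crossV2
    crossV2_surjective sum_crossV2_single
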